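/- For every finite alphabet Σ, all m, n ∈ ℕ_0, and every Z ∈ {X, Y, XY, WI}, the relation ≡_{m,n}^Z on the free monoid Σ* is a congruence of finite index: it is an equivalence relation such that u_1 ≡_{m,n}^Z u_2 and v_1 ≡_{m,n}^Z v_2 imply u_1 v_1 ≡_{m,n}^Z u_2 v_2, and it has only finitely many equivalence classes. -/

import Mathlib

open scoped Classical

/-! ## Generalized words -/

structure GWord (A : Type) : Type 1 where
  P : Type
  ord : LinearOrder P
  w : P → A

namespace GWord

variable {A : Type}

instance (u : GWord A) : LinearOrder u.P := u.ord

/-- The set of letters occurring in a generalized word. -/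
def alph (u : GWord A) : Set A := Set.range u.w

/-- Restriction of a generalized word to a set of positions. -/
def restrict (u : GWord A) (s : Set u.P) : GWord A :=
  ⟨{ p // p ∈ s }, inferInstance, fun p => u.w p.1⟩

/-- `p` is the first `a`-labelled position of `u`. -/
def IsFirst (u : GWord A) (a : A) (p : u.P) : Prop :=
  u.w p = a ∧ ∀ q : u.P, u.w q = a → p ≤ q

/-- `p` is the last `a`-labelled position of `u`. -/
def IsLast (u : GWord A) (a : A) (p : u.P) : Prop :=
  u.w p = a ∧ ∀ q : u.P, u.w q = a → q ≤ p

/-- The factor strictly before the first occurrence of `a`. -/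
noncomputable def XL (u : GWord A) (a : A) : GWord A :=
  if h : ∃ p, u.IsFirst a p then u.restrict {q | q < h.choose} else u

/-- The factor strictly after the first occurrence of `a`. -/
noncomputable def XR (u : GWord A) (a : A) : GWord A :=
  if h : ∃ p, u.IsFirst a p then u.restrict {q | h.choose < q} else u

/-- The factor strictly before the last occurrence of `a`. -/
noncomputable def YL (u : GWord A) (a : A) : GWord A :=
  if h : ∃ p, u.IsLast a p then u.restrict {q | q < h.choose} else u

/-- The factor strictly after the last occurrence of `a`. -/
noncomputable def YR (u : GWord A) (a : A) : GWord A :=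
  if h : ∃ p, u.IsLast a p then u.restrict {q | h.choose < q} else u

/-- `C_{a,b}` is defined iff the first `a` is strictly to the right of the last `b`. -/
def CDefined (u : GWord A) (a b : A) : Prop :=
  ∃ p q, u.IsFirst a p ∧ u.IsLast b q ∧ q < p

/-- The factor strictly between the last `b` and the first `a` (junk value if undefined). -/
noncomputable def Cab (u : GWord A) (a b : A) : GWord A :=
  if h : u.CDefined a b then
    u.restrict {r | h.choose_spec.choose < r ∧ r < h.choose}
  else u

/-- Accessibility: first/last occurrences of letters after/before every position exist. -/
def Accessible (u : GWord A) : Prop :=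
  (∀ a : A, (∃ p, u.w p = a) → ∃ p, u.IsFirst a p) ∧
  (∀ a : A, (∃ p, u.w p = a) → ∃ p, u.IsLast a p) ∧
  (∀ (p : u.P) (a : A), (∃ q, p < q ∧ u.w q = a) →
    ∃ q, p < q ∧ u.w q = a ∧ ∀ r, p < r → u.w r = a → q ≤ r) ∧
  (∀ (p : u.P) (a : A), (∃ q, q < p ∧ u.w q = a) →
    ∃ q, q < p ∧ u.w q = a ∧ ∀ r, r < p → u.w r = a → r ≤ q)

/-- Concatenation of generalized words. -/
def append (u v : GWord A) : GWord A :=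
  ⟨u.P ⊕ₗ v.P, inferInstance, fun x => Sum.elim u.w v.w (ofLex x)⟩

/-- The power of a generalized word by an arbitrary linear order type `ν`
(positions ordered with the exponent component dominant). -/
def gpow (u : GWord A) (ν : Type) [LinearOrder ν] : GWord A :=
  ⟨ν ×ₗ u.P, inferInstance, fun x => u.w (ofLex x).2⟩

/-- A finite word as a generalized word. -/
def ofList (l : List A) : GWord A :=
  ⟨Fin l.length, inferInstance, fun i => l.get i⟩

end GWord

/-- The order type `ω + ω*`: a copy of `ℕ` followed by a reversed copy of `ℕ`. -/
abbrev OO : Type := ℕ ⊕ₗ ℕᵒᵈ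

/-! ## The relations `≡_{m,n}^Z` -/

inductive ZK : Type
  | X | Y | WI

inductive ZKind : Type
  | X | Y | XY | WI

/-- The relations `≡_{m,n}^X`, `≡_{m,n}^Y`, `≡_{m,n}^{WI}` (first argument is `n`). -/
def eqvAux {A : Type} : ℕ → ZK → ℕ → GWord A → GWord A → Prop
  | 0, _, _, _, _ => True
  | _ + 1, _, 0, _, _ => True
  | n + 1, ZK.X, m + 1, u, v =>
      u.alph = v.alph ∧ eqvAux n ZK.Y m u v ∧
      ∀ a ∈ u.alph, eqvAux n ZK.Y m (u.XL a) (v.XL a) ∧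
        eqvAux n ZK.X (m + 1) (u.XR a) (v.XR a)
  | n + 1, ZK.Y, m + 1, u, v =>
      u.alph = v.alph ∧ eqvAux n ZK.X m u v ∧
      ∀ a ∈ u.alph, eqvAux n ZK.Y (m + 1) (u.YL a) (v.YL a) ∧
        eqvAux n ZK.X m (u.YR a) (v.YR a)
  | n + 1, ZK.WI, m + 1, u, v =>
      u.alph = v.alph ∧
      (∀ a ∈ u.alph,
        eqvAux n ZK.WI m (u.XL a) (v.XL a) ∧ eqvAux n ZK.WI (m + 1) (u.XR a) (v.XR a) ∧
        eqvAux n ZK.WI (m + 1) (u.YL a) (v.YL a) ∧ eqvAux n ZK.WI m (u.YR a) (v.YR a)) ∧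
      ∀ a ∈ u.alph, ∀ b ∈ u.alph,
        (u.CDefined a b ↔ v.CDefined a b) ∧
        (u.CDefined a b → v.CDefined a b → eqvAux n ZK.WI m (u.Cab a b) (v.Cab a b))

/-- `wEquiv Z m n u v` is `u ≡_{m,n}^Z v`. -/
def wEquiv {A : Type} (Z : ZKind) (m n : ℕ) (u v : GWord A) : Prop :=
  match Z with
  | ZKind.X => eqvAux n ZK.X m u v
  | ZKind.Y => eqvAux n ZK.Y m u v
  | ZKind.XY => eqvAux n ZK.X m u v ∧ eqvAux n ZK.Y m u v
  | ZKind.WI => eqvAux n ZK.WI m u v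

/-! ## π-terms -/

inductive PiTerm (A : Type) : Type
  | eps : PiTerm A
  | letter : A → PiTerm A
  | mul : PiTerm A → PiTerm A → PiTerm A
  | pi : PiTerm A → PiTerm A

def listNPow {A : Type} (l : List A) : ℕ → List A
  | 0 => []
  | k + 1 => l ++ listNPow l k

/-- `[γ]_k`: substitute the natural number `k` for the formal power `π`. -/
def PiTerm.substNat {A : Type} : PiTerm A → ℕ → List A
  | .eps, _ => []
  | .letter a, _ => [a]
  | .mul α β, k => α.substNat k ++ β.substNat k
  | .pi γ, k => listNPow (γ.substNat k) k

/-- `[γ]_{ω+ω*}`: substitute the order type `ω + ω*` for the formal power `π`. -/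
def PiTerm.substOO {A : Type} : PiTerm A → GWord A
  | .eps => GWord.ofList []
  | .letter a => GWord.ofList [a]
  | .mul α β => α.substOO.append β.substOO
  | .pi γ => γ.substOO.gpow OO

/-! ## Finite monoids, equations, the Trotter–Weil hierarchy -/

/-- `M!`: the exponent of a finite monoid, the least `n ≥ 1` such that all `x^n` are
idempotent. -/
noncomputable def monoidExp (M : Type) [Monoid M] : ℕ :=
  sInf {n : ℕ | 1 ≤ n ∧ ∀ x : M, IsIdempotentElem (x ^ n)}

/-- The equation `α = β` of π-terms holds in the finite monoid `M`. -/
def EqHoldsIn {A : Type} (α β : PiTerm A) (M : Type) [Monoid M] : Prop :=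
  ∀ σ : FreeMonoid A →* M,
    σ (FreeMonoid.ofList (α.substNat (monoidExp M))) =
      σ (FreeMonoid.ofList (β.substNat (monoidExp M)))

/-- Green's relation `R`: `x R y` iff `xM = yM`. -/
def rGreen {M : Type} [Monoid M] (x y : M) : Prop :=
  Set.range (fun z => x * z) = Set.range (fun z => y * z)

/-- Green's relation `L`: `x L y` iff `Mx = My`. -/
def lGreen {M : Type} [Monoid M] (x y : M) : Prop :=
  Set.range (fun z => z * x) = Set.range (fun z => z * y)

/-- `J`-triviality: `MxM = MyM` implies `x = y`. -/
def IsJTrivial (M : Type) [Monoid M] : Prop :=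
  ∀ x y : M, {z | ∃ a b, z = a * x * b} = {z | ∃ a b, z = a * y * b} → x = y

/-- The relation `∼_K`. -/
def simK {M : Type} [Monoid M] (x y : M) : Prop :=
  ∀ e : M, IsIdempotentElem e → (rGreen (e * x) e ∨ rGreen (e * y) e) → e * x = e * y

/-- The relation `∼_D`. -/
def simD {M : Type} [Monoid M] (x y : M) : Prop :=
  ∀ e : M, IsIdempotentElem e → (lGreen (x * e) e ∨ lGreen (y * e) e) → x * e = y * e

/-- `∼_K` as a congruence (it is a congruence, so `conGen` does not change it). -/
def KCon (M : Type) [Monoid M] : Con M := conGen simK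

/-- `∼_D` as a congruence. -/
def DCon (M : Type) [Monoid M] : Con M := conGen simD

/-- `InRLAux k true M _ = (M ∈ R_{k+1})` and `InRLAux k false M _ = (M ∈ L_{k+1})`. -/
def InRLAux : ℕ → Bool → (M : Type) → Monoid M → Prop
  | 0, _, M, i => letI := i; IsJTrivial M
  | k + 1, true, M, i => letI := i; InRLAux k false (KCon M).Quotient inferInstance
  | k + 1, false, M, i => letI := i; InRLAux k true (DCon M).Quotient inferInstance

/-- `M ∈ R_m` (for `m ≥ 1`). -/
def InRm (m : ℕ) (M : Type) [i : Monoid M] : Prop := InRLAux (m - 1) true M i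

/-- `M ∈ L_m` (for `m ≥ 1`). -/
def InLm (m : ℕ) (M : Type) [i : Monoid M] : Prop := InRLAux (m - 1) false M i

/-- `N` divides `M`: `N` is a homomorphic image of a submonoid of `M`. -/
def MDivides (N M : Type) [Monoid N] [Monoid M] : Prop :=
  ∃ (S : Submonoid M) (f : S →* N), Function.Surjective f

/-- `N ∈ R_m ∨ L_m`: `N` divides a direct product `M₁ × M₂` with `M₁ ∈ R_m`, `M₂ ∈ L_m`. -/
def InJoin (m : ℕ) (N : Type) [Monoid N] : Prop :=
  ∃ (M₁ M₂ : Type) (i₁ : Monoid M₁) (i₂ : Monoid M₂),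
    letI := i₁; letI := i₂;
    Finite M₁ ∧ Finite M₂ ∧ InRm m M₁ ∧ InLm m M₂ ∧ MDivides N (M₁ × M₂)

/-- `M ∈ DA`, via the equation `(xyz)^{M!} y (xyz)^{M!} = (xyz)^{M!}`. -/
def InDA (M : Type) [Monoid M] : Prop :=
  ∀ x y z : M,
    (x * y * z) ^ monoidExp M * y * (x * y * z) ^ monoidExp M = (x * y * z) ^ monoidExp M

/-! ## The π-terms `U_m`, `V_m` -/

inductive UVLetter : Type
  | s | t | x (i : ℕ) | y (i : ℕ)

/-- `U_m` (indexed from 1; `Uterm 0` is a junk value). -/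
def Uterm : ℕ → PiTerm UVLetter
  | 0 => PiTerm.eps
  | 1 =>
      PiTerm.mul
        (PiTerm.pi (PiTerm.mul (PiTerm.letter UVLetter.s) (PiTerm.letter (UVLetter.x 1))))
        (PiTerm.mul (PiTerm.letter UVLetter.s)
          (PiTerm.pi (PiTerm.mul (PiTerm.letter (UVLetter.y 1)) (PiTerm.letter UVLetter.t))))
  | m + 2 =>
      PiTerm.mul
        (PiTerm.pi (PiTerm.mul (Uterm (m + 1)) (PiTerm.letter (UVLetter.x (m + 2)))))
        (PiTerm.mul (Uterm (m + 1))
          (PiTerm.pi (PiTerm.mul (PiTerm.letter (UVLetter.y (m + 2))) (Uterm (m + 1)))))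

/-- `V_m` (indexed from 1; `Vterm 0` is a junk value). -/
def Vterm : ℕ → PiTerm UVLetter
  | 0 => PiTerm.eps
  | 1 =>
      PiTerm.mul
        (PiTerm.pi (PiTerm.mul (PiTerm.letter UVLetter.s) (PiTerm.letter (UVLetter.x 1))))
        (PiTerm.mul (PiTerm.letter UVLetter.t)
          (PiTerm.pi (PiTerm.mul (PiTerm.letter (UVLetter.y 1)) (PiTerm.letter UVLetter.t))))
  | m + 2 =>
      PiTerm.mul
        (PiTerm.pi (PiTerm.mul (Uterm (m + 1)) (PiTerm.letter (UVLetter.x (m + 2)))))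
        (PiTerm.mul (Vterm (m + 1))
          (PiTerm.pi (PiTerm.mul (PiTerm.letter (UVLetter.y (m + 2))) (Uterm (m + 1)))))

/-- The relation `≡_{m,n}^Z` on the free monoid `Σ*`, as a congruence
(it is a congruence, so `conGen` does not change it). -/
def eqvCon (A : Type) (Z : ZKind) (m n : ℕ) : Con (FreeMonoid A) :=
  conGen (fun u v => wEquiv Z m n (GWord.ofList u.toList) (GWord.ofList v.toList))

namespace GWord

variable {A : Type} {u v w : GWord A} {a b : A}

theorem IsFirst.unique {p q : u.P} (hp : u.IsFirst a p) (hq : u.IsFirst a q) : p = q :=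
  le_antisymm (hp.2 _ hq.1) (hq.2 _ hp.1)

theorem IsLast.unique {p q : u.P} (hp : u.IsLast a p) (hq : u.IsLast a q) : p = q :=
  le_antisymm (hq.2 _ hp.1) (hp.2 _ hq.1)

theorem IsFirst.XL_eq {p : u.P} (h : u.IsFirst a p) : u.XL a = u.restrict {q | q < p} := by
  have hex : ∃ p, u.IsFirst a p := ⟨p, h⟩
  rw [XL, dif_pos hex, hex.choose_spec.unique h]

theorem IsFirst.XR_eq {p : u.P} (h : u.IsFirst a p) : u.XR a = u.restrict {q | p < q} := by
  have hex : ∃ p, u.IsFirst a p := ⟨p, h⟩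
  rw [XR, dif_pos hex, hex.choose_spec.unique h]

theorem IsLast.YL_eq {p : u.P} (h : u.IsLast a p) : u.YL a = u.restrict {q | q < p} := by
  have hex : ∃ p, u.IsLast a p := ⟨p, h⟩
  rw [YL, dif_pos hex, hex.choose_spec.unique h]

theorem IsLast.YR_eq {p : u.P} (h : u.IsLast a p) : u.YR a = u.restrict {q | p < q} := by
  have hex : ∃ p, u.IsLast a p := ⟨p, h⟩
  rw [YR, dif_pos hex, hex.choose_spec.unique h]

theorem Cab_eq {p q : u.P} (hp : u.IsFirst a p) (hq : u.IsLast b q) (hqp : q < p) :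
    u.Cab a b = u.restrict {r | q < r ∧ r < p} := by
  have h : u.CDefined a b := ⟨p, q, hp, hq, hqp⟩
  obtain ⟨h₁, h₂, -⟩ := h.choose_spec.choose_spec
  rw [Cab, dif_pos h, h₂.unique hq, h₁.unique hp]

/-- The positions of `u`, listed in increasing order, carry the labels `l`. -/
def Spells (u : GWord A) (l : List A) : Prop :=
  ∃ ps : List u.P, ps.Pairwise (· < ·) ∧ (∀ p, p ∈ ps) ∧ ps.map u.w = l

theorem spells_ofList (l : List A) : (ofList l).Spells l :=
  ⟨List.finRange l.length, List.pairwise_lt_finRange _, List.mem_finRange,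
    List.map_get_finRange l⟩

theorem Spells.mem_alph_iff {l : List A} (h : u.Spells l) : a ∈ u.alph ↔ a ∈ l := by
  obtain ⟨ps, -, hmem, rfl⟩ := h
  simp [alph, hmem]

theorem spells_restrict {s : Set u.P} {ps : List u.P} (hlt : ps.Pairwise (· < ·))
    (hmem : ∀ p, p ∈ ps ↔ p ∈ s) : (u.restrict s).Spells (ps.map u.w) := by
  refine ⟨ps.attachWith (· ∈ s) fun p hp => (hmem p).1 hp, ?_, fun p => ?_,
    List.attachWith_map_val _⟩
  · exact List.pairwise_pmap (f := Subtype.mk) _ |>.2 (hlt.imp fun h _ _ => h)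
  · exact (List.mem_attachWith _ p).2 ((hmem p.1).2 p.2)

theorem Spells.exists_position {x y : List A} (h : u.Spells (x ++ a :: y)) :
    ∃ (p : u.P) (xs ys : List u.P), u.w p = a ∧ xs.map u.w = x ∧ ys.map u.w = y ∧
      xs.Pairwise (· < ·) ∧ ys.Pairwise (· < ·) ∧
      (∀ q, q ∈ xs ↔ q < p) ∧ ∀ q, q ∈ ys ↔ p < q := by
  obtain ⟨ps, hlt, hmem, heq⟩ := h
  obtain ⟨xs, t, rfl, hx, ht⟩ := List.map_eq_append_iff.1 heq
  obtain ⟨p, ys, rfl, hp, hy⟩ := List.map_eq_cons_iff.1 ht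
  simp only [List.pairwise_append, List.pairwise_cons, List.mem_cons, List.mem_append] at hlt hmem
  obtain ⟨hxs, ⟨hpy, hys⟩, hxy⟩ := hlt
  have hxp : ∀ q ∈ xs, q < p := fun q hq => hxy q hq p (.inl rfl)
  refine ⟨p, xs, ys, hp, hx, hy, hxs, hys, fun q => ⟨hxp q, fun hq => ?_⟩,
    fun q => ⟨hpy q, fun hq => ?_⟩⟩
  · rcases hmem q with h | rfl | h
    · exact h
    · exact absurd hq (lt_irrefl _)
    · exact absurd hq (hpy q h).asymm
  · rcases hmem q with h | rfl | h
    · exact absurd hq (hxp q h).asymm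
    · exact absurd hq (lt_irrefl _)
    · exact h

theorem Spells.XL_XR {x y : List A} (h : u.Spells (x ++ a :: y)) (ha : a ∉ x) :
    (u.XL a).Spells x ∧ (u.XR a).Spells y := by
  obtain ⟨p, xs, ys, hp, rfl, rfl, hxs, hys, hx, hy⟩ := h.exists_position
  have hf : u.IsFirst a p :=
    ⟨hp, fun q hq => not_lt.1 fun hqp => ha (List.mem_map.2 ⟨q, (hx q).2 hqp, hq⟩)⟩
  rw [hf.XL_eq, hf.XR_eq]
  exact ⟨spells_restrict hxs hx, spells_restrict hys hy⟩

theorem Spells.YL_YR {x y : List A} (h : u.Spells (x ++ a :: y)) (ha : a ∉ y) :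
    (u.YL a).Spells x ∧ (u.YR a).Spells y := by
  obtain ⟨p, xs, ys, hp, rfl, rfl, hxs, hys, hx, hy⟩ := h.exists_position
  have hf : u.IsLast a p :=
    ⟨hp, fun q hq => not_lt.1 fun hqp => ha (List.mem_map.2 ⟨q, (hy q).2 hqp, hq⟩)⟩
  rw [hf.YL_eq, hf.YR_eq]
  exact ⟨spells_restrict hxs hx, spells_restrict hys hy⟩

theorem Spells.CDefined_Cab {x y z : List A} (h : u.Spells (x ++ b :: (y ++ a :: z)))
    (ha : a ∉ x ++ b :: y) (hb : b ∉ y ++ a :: z) :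
    u.CDefined a b ∧ (u.Cab a b).Spells y := by
  obtain ⟨q, xs, ts, hq, hx, ht, hxs, hts, hxm, htm⟩ := h.exists_position
  obtain ⟨ys, t, rfl, rfl, ht'⟩ := List.map_eq_append_iff.1 ht
  obtain ⟨p, zs, rfl, hp, rfl⟩ := List.map_eq_cons_iff.1 ht'
  subst hx
  simp only [List.pairwise_append, List.pairwise_cons, List.mem_cons] at hts
  obtain ⟨hys, ⟨hpz, hzs⟩, hyz⟩ := hts
  have hyp : ∀ r ∈ ys, r < p := fun r hr => hyz r hr p (.inl rfl)
  have hqp : q < p := (htm p).1 (by simp)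
  have hym : ∀ r, r ∈ ys ↔ r ∈ {r | q < r ∧ r < p} := by
    refine fun r => ⟨fun hr => ⟨(htm r).1 (by simp [hr]), hyp r hr⟩, fun ⟨h₁, h₂⟩ => ?_⟩
    have hr := (htm r).2 h₁
    simp only [List.mem_append, List.mem_cons] at hr
    rcases hr with hr | rfl | hr
    · exact hr
    · exact absurd h₂ (lt_irrefl _)
    · exact absurd h₂ (hpz r hr).asymm
  have hlast : u.IsLast b q := by
    refine ⟨hq, fun r hr => not_lt.1 fun hqr => hb ?_⟩
    have := List.mem_map.2 ⟨r, (htm r).2 hqr, hr⟩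
    simpa [hp] using this
  have hfirst : u.IsFirst a p := by
    refine ⟨hp, fun r hr => not_lt.1 fun hrp => ha ?_⟩
    rcases lt_trichotomy r q with h | rfl | h
    · exact List.mem_append_left _ (List.mem_map.2 ⟨r, (hxm r).2 h, hr⟩)
    · simp [← hr, ← hq]
    · have := List.mem_map.2 ⟨r, (hym r).2 ⟨h, hrp⟩, hr⟩
      exact List.mem_append_right _ (List.mem_cons_of_mem _ this)
  refine ⟨⟨p, q, hfirst, hlast, hqp⟩, ?_⟩
  rw [Cab_eq hfirst hlast hqp]
  exact spells_restrict hys hym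

theorem Spells.exists_eq_of_CDefined {l : List A} (h : u.Spells l) (hC : u.CDefined a b) :
    ∃ x y z, l = x ++ b :: (y ++ a :: z) ∧ a ∉ x ++ b :: y ∧ b ∉ y ++ a :: z := by
  obtain ⟨ps, hlt, hmem, rfl⟩ := h
  obtain ⟨p, q, ⟨rfl, hp⟩, ⟨rfl, hq⟩, hqp⟩ := hC
  obtain ⟨xs, ts, rfl⟩ := List.append_of_mem (hmem q)
  simp only [List.pairwise_append, List.pairwise_cons, List.mem_cons] at hlt
  obtain ⟨hxs, ⟨hqt, hts⟩, hxt⟩ := hlt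
  have hpt : p ∈ ts := by
    have := hmem p
    simp only [List.mem_append, List.mem_cons] at this
    rcases this with h | rfl | h
    · exact absurd hqp (hxt p h q (.inl rfl)).asymm
    · exact absurd hqp (lt_irrefl _)
    · exact h
  obtain ⟨ys, zs, rfl⟩ := List.append_of_mem hpt
  simp only [List.pairwise_append, List.mem_cons] at hts
  refine ⟨xs.map u.w, ys.map u.w, zs.map u.w, by simp, fun h => ?_, fun h => ?_⟩
  · have : u.w p ∈ (xs ++ q :: ys).map u.w := by simpa using h
    obtain ⟨r, hr, hrp⟩ := List.mem_map.1 this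
    refine absurd (hp r hrp) (not_le.2 ?_)
    simp only [List.mem_append, List.mem_cons] at hr
    rcases hr with hr | rfl | hr
    · exact hxt r hr p (by simp)
    · exact hqp
    · exact hts.2.2 r hr p (.inl rfl)
  · have : u.w q ∈ (ys ++ p :: zs).map u.w := by simpa using h
    obtain ⟨r, hr, hrq⟩ := List.mem_map.1 this
    exact absurd (hq r hrq) (not_le.2 (hqt r hr))

theorem exists_eq_append_cons_last {l : List A} (h : a ∈ l) :
    ∃ x y, l = x ++ a :: y ∧ a ∉ y := by
  obtain ⟨x, y, hl, hx⟩ := List.eq_append_cons_of_mem (List.mem_reverse.2 h)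
  refine ⟨y.reverse, x.reverse, ?_, by simpa using hx⟩
  rw [← List.reverse_reverse l, hl]
  simp

/-- `w` is a concatenation of the finite words `u` and `v`, up to isomorphism. -/
def IsCat (u v w : GWord A) : Prop :=
  ∃ x y, u.Spells x ∧ v.Spells y ∧ w.Spells (x ++ y)

namespace IsCat

theorem mem_alph_iff (h : IsCat u v w) : a ∈ w.alph ↔ a ∈ u.alph ∨ a ∈ v.alph := by
  obtain ⟨x, y, hu, hv, hw⟩ := h
  rw [hu.mem_alph_iff, hv.mem_alph_iff, hw.mem_alph_iff, List.mem_append]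

theorem alph_eq (h : IsCat u v w) : w.alph = u.alph ∪ v.alph :=
  Set.ext fun _ => h.mem_alph_iff

theorem X_of_mem (h : IsCat u v w) (ha : a ∈ u.alph) :
    IsCat (u.XL a) (ofList []) (w.XL a) ∧ IsCat (u.XR a) v (w.XR a) := by
  obtain ⟨x, y, hu, hv, hw⟩ := h
  obtain ⟨s, t, rfl, hs⟩ := List.eq_append_cons_of_mem (hu.mem_alph_iff.1 ha)
  obtain ⟨h₁, h₂⟩ := hu.XL_XR hs
  obtain ⟨h₃, h₄⟩ := Spells.XL_XR (y := t ++ y) (by simpa using hw) hs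
  exact ⟨⟨s, [], h₁, spells_ofList _, by simpa using h₃⟩, ⟨t, y, h₂, hv, h₄⟩⟩

theorem X_of_notMem (h : IsCat u v w) (hau : a ∉ u.alph) (ha : a ∈ v.alph) :
    IsCat u (v.XL a) (w.XL a) ∧ IsCat (ofList []) (v.XR a) (w.XR a) := by
  obtain ⟨x, y, hu, hv, hw⟩ := h
  obtain ⟨s, t, rfl, hs⟩ := List.eq_append_cons_of_mem (hv.mem_alph_iff.1 ha)
  rw [hu.mem_alph_iff] at hau
  obtain ⟨h₁, h₂⟩ := hv.XL_XR hs
  obtain ⟨h₃, h₄⟩ := Spells.XL_XR (x := x ++ s) (by simpa using hw) (by simp [hau, hs])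
  exact ⟨⟨x, s, hu, h₁, h₃⟩, ⟨[], t, spells_ofList _, h₂, h₄⟩⟩

theorem Y_of_mem (h : IsCat u v w) (ha : a ∈ v.alph) :
    IsCat u (v.YL a) (w.YL a) ∧ IsCat (ofList []) (v.YR a) (w.YR a) := by
  obtain ⟨x, y, hu, hv, hw⟩ := h
  obtain ⟨s, t, rfl, hs⟩ := exists_eq_append_cons_last (hv.mem_alph_iff.1 ha)
  obtain ⟨h₁, h₂⟩ := hv.YL_YR hs
  obtain ⟨h₃, h₄⟩ := Spells.YL_YR (x := x ++ s) (by simpa using hw) hs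
  exact ⟨⟨x, s, hu, h₁, h₃⟩, ⟨[], t, spells_ofList _, h₂, h₄⟩⟩

theorem Y_of_notMem (h : IsCat u v w) (ha : a ∈ u.alph) (hav : a ∉ v.alph) :
    IsCat (u.YL a) (ofList []) (w.YL a) ∧ IsCat (u.YR a) v (w.YR a) := by
  obtain ⟨x, y, hu, hv, hw⟩ := h
  obtain ⟨s, t, rfl, hs⟩ := exists_eq_append_cons_last (hu.mem_alph_iff.1 ha)
  rw [hv.mem_alph_iff] at hav
  obtain ⟨h₁, h₂⟩ := hu.YL_YR hs
  obtain ⟨h₃, h₄⟩ := Spells.YL_YR (y := t ++ y) (by simpa using hw) (by simp [hav, hs])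
  exact ⟨⟨s, [], h₁, spells_ofList _, by simpa using h₃⟩, ⟨t, y, h₂, hv, h₄⟩⟩

theorem C_left (h : IsCat u v w) (hC : u.CDefined a b) (hb : b ∉ v.alph) :
    w.CDefined a b ∧ IsCat (u.Cab a b) (ofList []) (w.Cab a b) := by
  obtain ⟨x, y, hu, hv, hw⟩ := h
  obtain ⟨r, s, t, rfl, h₁, h₂⟩ := hu.exists_eq_of_CDefined hC
  rw [hv.mem_alph_iff] at hb
  obtain ⟨h₃, h₄⟩ := Spells.CDefined_Cab (z := t ++ y) (by simpa using hw) h₁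
    (fun hm => (List.mem_append.1 (by simpa using hm : b ∈ (s ++ a :: t) ++ y)).elim h₂ hb)
  exact ⟨h₃, s, [], (hu.CDefined_Cab h₁ h₂).2, spells_ofList _, by simpa using h₄⟩

theorem C_right (h : IsCat u v w) (hC : v.CDefined a b) (ha : a ∉ u.alph) :
    w.CDefined a b ∧ IsCat (ofList []) (v.Cab a b) (w.Cab a b) := by
  obtain ⟨x, y, hu, hv, hw⟩ := h
  obtain ⟨r, s, t, rfl, h₁, h₂⟩ := hv.exists_eq_of_CDefined hC
  rw [hu.mem_alph_iff] at ha
  obtain ⟨h₃, h₄⟩ := Spells.CDefined_Cab (x := x ++ r) (by simpa using hw)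
    (fun hm => (List.mem_append.1 (by simpa using hm : a ∈ x ++ (r ++ b :: s))).elim ha h₁) h₂
  exact ⟨h₃, [], s, spells_ofList _, (hv.CDefined_Cab h₁ h₂).2, h₄⟩

theorem C_middle (h : IsCat u v w) (hau : a ∉ u.alph) (hav : a ∈ v.alph) (hbu : b ∈ u.alph)
    (hbv : b ∉ v.alph) :
    w.CDefined a b ∧ IsCat (u.YR b) (v.XL a) (w.Cab a b) := by
  obtain ⟨x, y, hu, hv, hw⟩ := h
  rw [hu.mem_alph_iff] at hau hbu
  rw [hv.mem_alph_iff] at hav hbv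
  obtain ⟨s, t, rfl, ht⟩ := exists_eq_append_cons_last hbu
  obtain ⟨s', t', rfl, hs'⟩ := List.eq_append_cons_of_mem hav
  obtain ⟨h₁, h₂⟩ := Spells.CDefined_Cab (x := s) (y := t ++ s') (z := t') (a := a) (b := b)
    (by simpa using hw) (by simp_all) (by simp_all)
  exact ⟨h₁, t, s', (hu.YL_YR ht).2, (hv.XL_XR hs').1, h₂⟩

theorem CDefined_cases (h : IsCat u v w) (hC : w.CDefined a b) :
    (u.CDefined a b ∧ b ∉ v.alph) ∨ (v.CDefined a b ∧ a ∉ u.alph) ∨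
      (a ∉ u.alph ∧ a ∈ v.alph ∧ b ∈ u.alph ∧ b ∉ v.alph) := by
  obtain ⟨l₁, l₂, hu, hv, hw⟩ := h
  obtain ⟨x, y, z, heq, h₁, h₂⟩ := hw.exists_eq_of_CDefined hC
  rw [hu.mem_alph_iff, hv.mem_alph_iff, hu.mem_alph_iff, hv.mem_alph_iff]
  rcases List.append_eq_append_iff.1 heq with ⟨s, rfl, rfl⟩ | ⟨s, rfl, hs⟩ <;> clear heq
  · exact .inr (.inl ⟨(hv.CDefined_Cab (by simp_all) h₂).1, by simp_all⟩)
  rcases List.cons_eq_append_iff.1 hs with ⟨rfl, rfl⟩ | ⟨s, rfl, hs'⟩ <;> clear hs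
  · exact .inr (.inl ⟨(Spells.CDefined_Cab (x := []) hv (by simp_all) h₂).1, by simp_all⟩)
  rcases List.append_eq_append_iff.1 hs' with ⟨t, rfl, ht⟩ | ⟨t, rfl, rfl⟩ <;> clear hs'
  · rcases List.cons_eq_append_iff.1 ht with ⟨rfl, rfl⟩ | ⟨t, rfl, rfl⟩ <;> clear ht
    · exact .inr (.inr (by simp_all))
    · exact .inl ⟨(hu.CDefined_Cab h₁ (by simp_all)).1, by simp_all⟩
  · exact .inr (.inr (by simp_all))

end IsCat

theorem isCat_ofList (x y : List A) : IsCat (ofList x) (ofList y) (ofList (x ++ y)) :=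
  ⟨x, y, spells_ofList x, spells_ofList y, spells_ofList _⟩

end GWord

open GWord

theorem eqvAux_refl {A : Type} (n : ℕ) (k : ZK) (m : ℕ) (u : GWord A) : eqvAux n k m u u := by
  induction n generalizing k m u with
  | zero => simp [eqvAux]
  | succ n ih => cases m <;> cases k <;> simp [eqvAux, ih]

theorem eqvAux_symm {A : Type} {n : ℕ} {k : ZK} {m : ℕ} {u v : GWord A}
    (h : eqvAux n k m u v) : eqvAux n k m v u := by
  induction n generalizing k m u v with
  | zero => simp [eqvAux]
  | succ n ih =>
    rcases m with - | m
    · simp [eqvAux]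
    cases k <;> simp only [eqvAux] at h ⊢
    case WI =>
      obtain ⟨h₀, h₁, h₂⟩ := h
      rw [← h₀]
      exact ⟨rfl, fun a ha => ⟨ih (h₁ a ha).1, ih (h₁ a ha).2.1, ih (h₁ a ha).2.2.1,
        ih (h₁ a ha).2.2.2⟩, fun a ha b hb => ⟨(h₂ a ha b hb).1.symm,
        fun hv hu => ih ((h₂ a ha b hb).2 hu hv)⟩⟩
    all_goals
      obtain ⟨h₀, h₁, h₂⟩ := h
      rw [← h₀]
      exact ⟨rfl, ih h₁, fun a ha => ⟨ih (h₂ a ha).1, ih (h₂ a ha).2⟩⟩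

theorem eqvAux_trans {A : Type} {n : ℕ} {k : ZK} {m : ℕ} {u v w : GWord A}
    (h : eqvAux n k m u v) (h' : eqvAux n k m v w) : eqvAux n k m u w := by
  induction n generalizing k m u v w with
  | zero => simp [eqvAux]
  | succ n ih =>
    rcases m with - | m
    · simp [eqvAux]
    cases k <;> simp only [eqvAux] at h h' ⊢
    case WI =>
      obtain ⟨h₀, h₁, h₂⟩ := h
      rw [← h₀] at h'
      obtain ⟨h₀', h₁', h₂'⟩ := h'
      refine ⟨h₀', fun a ha => ?_, fun a ha b hb => ?_⟩
      · obtain ⟨l₁, l₂, l₃, l₄⟩ := h₁ a ha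
        obtain ⟨r₁, r₂, r₃, r₄⟩ := h₁' a ha
        exact ⟨ih l₁ r₁, ih l₂ r₂, ih l₃ r₃, ih l₄ r₄⟩
      · obtain ⟨l₁, l₂⟩ := h₂ a ha b hb
        obtain ⟨r₁, r₂⟩ := h₂' a ha b hb
        exact ⟨l₁.trans r₁, fun hu hw => ih (l₂ hu (l₁.1 hu)) (r₂ (l₁.1 hu) hw)⟩
    all_goals
      obtain ⟨h₀, h₁, h₂⟩ := h
      rw [← h₀] at h'
      obtain ⟨h₀', h₁', h₂'⟩ := h'
      exact ⟨h₀', ih h₁ h₁', fun a ha => ⟨ih (h₂ a ha).1 (h₂' a ha).1,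
        ih (h₂ a ha).2 (h₂' a ha).2⟩⟩

theorem eqvAux_of_succ {A : Type} {n : ℕ} {k : ZK} {m : ℕ} {u v : GWord A}
    (h : eqvAux (n + 1) k m u v) : eqvAux n k m u v := by
  induction n generalizing k m u v with
  | zero => simp [eqvAux]
  | succ n ih =>
    rcases m with - | m
    · simp [eqvAux]
    cases k <;> rw [eqvAux] at h ⊢
    case WI =>
      exact ⟨h.1, fun a ha => ⟨ih (h.2.1 a ha).1, ih (h.2.1 a ha).2.1, ih (h.2.1 a ha).2.2.1,
        ih (h.2.1 a ha).2.2.2⟩, fun a ha b hb => ⟨(h.2.2 a ha b hb).1,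
        fun hu hv => ih ((h.2.2 a ha b hb).2 hu hv)⟩⟩
    all_goals exact ⟨h.1, ih h.2.1, fun a ha => ⟨ih (h.2.2 a ha).1, ih (h.2.2 a ha).2⟩⟩

theorem eqvAux_of_succ_right {A : Type} {n : ℕ} {k : ZK} {m : ℕ} {u v : GWord A}
    (h : eqvAux n k (m + 1) u v) : eqvAux n k m u v := by
  induction n generalizing k m u v with
  | zero => simp [eqvAux]
  | succ n ih =>
    rcases m with - | m
    · simp [eqvAux]
    cases k <;> rw [eqvAux] at h ⊢
    case WI =>
      exact ⟨h.1, fun a ha => ⟨ih (h.2.1 a ha).1, ih (h.2.1 a ha).2.1, ih (h.2.1 a ha).2.2.1,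
        ih (h.2.1 a ha).2.2.2⟩, fun a ha b hb => ⟨(h.2.2 a ha b hb).1,
        fun hu hv => ih ((h.2.2 a ha b hb).2 hu hv)⟩⟩
    all_goals exact ⟨h.1, ih h.2.1, fun a ha => ⟨ih (h.2.2 a ha).1, ih (h.2.2 a ha).2⟩⟩

theorem GWord.CDefined.mem_alph {A : Type} {u : GWord A} {a b : A} (h : u.CDefined a b) :
    a ∈ u.alph ∧ b ∈ u.alph := by
  obtain ⟨p, q, hp, hq, -⟩ := h
  exact ⟨⟨p, hp.1⟩, ⟨q, hq.1⟩⟩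

theorem CDefined_and_eqvAux_Cab {A : Type} {n m : ℕ} {u₁ u₂ v₁ v₂ w₁ w₂ : GWord A} {a b : A}
    (ih : ∀ {x₁ x₂ y₁ y₂ z₁ z₂ : GWord A}, IsCat x₁ y₁ z₁ → IsCat x₂ y₂ z₂ →
      eqvAux n ZK.WI m x₁ x₂ → eqvAux n ZK.WI m y₁ y₂ → eqvAux n ZK.WI m z₁ z₂)
    (c₁ : IsCat u₁ v₁ w₁) (c₂ : IsCat u₂ v₂ w₂)
    (hu : eqvAux (n + 1) ZK.WI (m + 1) u₁ u₂) (hv : eqvAux (n + 1) ZK.WI (m + 1) v₁ v₂)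
    (hC : w₁.CDefined a b) :
    w₂.CDefined a b ∧ eqvAux n ZK.WI m (w₁.Cab a b) (w₂.Cab a b) := by
  rw [eqvAux] at hu hv
  obtain ⟨au, hu₁, hu₂⟩ := hu
  obtain ⟨av, hv₁, hv₂⟩ := hv
  rcases c₁.CDefined_cases hC with ⟨hCu, hb⟩ | ⟨hCv, ha⟩ | ⟨hau, hav, hbu, hbv⟩
  · obtain ⟨h₁, h₂⟩ := hu₂ a hCu.mem_alph.1 b hCu.mem_alph.2
    have d₁ := c₁.C_left hCu hb
    have d₂ := c₂.C_left (h₁.1 hCu) (av ▸ hb)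
    exact ⟨d₂.1, ih d₁.2 d₂.2 (h₂ hCu (h₁.1 hCu)) (eqvAux_refl ..)⟩
  · obtain ⟨h₁, h₂⟩ := hv₂ a hCv.mem_alph.1 b hCv.mem_alph.2
    have d₁ := c₁.C_right hCv ha
    have d₂ := c₂.C_right (h₁.1 hCv) (au ▸ ha)
    exact ⟨d₂.1, ih d₁.2 d₂.2 (eqvAux_refl ..) (h₂ hCv (h₁.1 hCv))⟩
  · have d₁ := c₁.C_middle hau hav hbu hbv
    have d₂ := c₂.C_middle (au ▸ hau) (av ▸ hav) (au ▸ hbu) (av ▸ hbv)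
    exact ⟨d₂.1, ih d₁.2 d₂.2 (hu₁ b hbu).2.2.2 (hv₁ a hav).1⟩

theorem eqvAux_of_isCat {A : Type} {n : ℕ} {k : ZK} {m : ℕ} {u₁ u₂ v₁ v₂ w₁ w₂ : GWord A}
    (c₁ : IsCat u₁ v₁ w₁) (c₂ : IsCat u₂ v₂ w₂)
    (hu : eqvAux n k m u₁ u₂) (hv : eqvAux n k m v₁ v₂) : eqvAux n k m w₁ w₂ := by
  induction n generalizing k m u₁ u₂ v₁ v₂ w₁ w₂ with
  | zero => simp [eqvAux]
  | succ n ih =>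
    rcases m with - | m
    · simp [eqvAux]
    have hu' := eqvAux_of_succ hu
    have hv' := eqvAux_of_succ hv
    have hu₀ := hu
    have hv₀ := hv
    cases k <;> rw [eqvAux] at hu hv ⊢ <;> obtain ⟨au, hu₁, hu₂⟩ := hu <;>
      obtain ⟨av, hv₁, hv₂⟩ := hv <;>
      refine ⟨by rw [c₁.alph_eq, c₂.alph_eq, au, av], ?_, ?_⟩
    case X.refine_1 => exact ih c₁ c₂ hu₁ hv₁
    case Y.refine_1 => exact ih c₁ c₂ hu₁ hv₁
    case X.refine_2 =>
      intro a ha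
      by_cases hau : a ∈ u₁.alph
      · have d₁ := c₁.X_of_mem hau
        have d₂ := c₂.X_of_mem (au ▸ hau)
        exact ⟨ih d₁.1 d₂.1 (hu₂ a hau).1 (eqvAux_refl ..), ih d₁.2 d₂.2 (hu₂ a hau).2 hv'⟩
      · have hav := (c₁.mem_alph_iff.1 ha).resolve_left hau
        have d₁ := c₁.X_of_notMem hau hav
        have d₂ := c₂.X_of_notMem (au ▸ hau) (av ▸ hav)
        exact ⟨ih d₁.1 d₂.1 hu₁ (hv₂ a hav).1, ih d₁.2 d₂.2 (eqvAux_refl ..) (hv₂ a hav).2⟩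
    case Y.refine_2 =>
      intro a ha
      by_cases hav : a ∈ v₁.alph
      · have d₁ := c₁.Y_of_mem hav
        have d₂ := c₂.Y_of_mem (av ▸ hav)
        exact ⟨ih d₁.1 d₂.1 hu' (hv₂ a hav).1, ih d₁.2 d₂.2 (eqvAux_refl ..) (hv₂ a hav).2⟩
      · have hau := (c₁.mem_alph_iff.1 ha).resolve_right hav
        have d₁ := c₁.Y_of_notMem hau hav
        have d₂ := c₂.Y_of_notMem (au ▸ hau) (av ▸ hav)
        exact ⟨ih d₁.1 d₂.1 (hu₂ a hau).1 (eqvAux_refl ..), ih d₁.2 d₂.2 (hu₂ a hau).2 hv₁⟩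
    case WI.refine_1 =>
      intro a ha
      refine and_assoc.1 ⟨?_, ?_⟩
      · by_cases hau : a ∈ u₁.alph
        · have d₁ := c₁.X_of_mem hau
          have d₂ := c₂.X_of_mem (au ▸ hau)
          exact ⟨ih d₁.1 d₂.1 (hu₁ a hau).1 (eqvAux_refl ..),
            ih d₁.2 d₂.2 (hu₁ a hau).2.1 hv'⟩
        · have hav := (c₁.mem_alph_iff.1 ha).resolve_left hau
          have d₁ := c₁.X_of_notMem hau hav
          have d₂ := c₂.X_of_notMem (au ▸ hau) (av ▸ hav)
          exact ⟨ih d₁.1 d₂.1 (eqvAux_of_succ_right hu') (hv₁ a hav).1,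
            ih d₁.2 d₂.2 (eqvAux_refl ..) (hv₁ a hav).2.1⟩
      · by_cases hav : a ∈ v₁.alph
        · have d₁ := c₁.Y_of_mem hav
          have d₂ := c₂.Y_of_mem (av ▸ hav)
          exact ⟨ih d₁.1 d₂.1 hu' (hv₁ a hav).2.2.1,
            ih d₁.2 d₂.2 (eqvAux_refl ..) (hv₁ a hav).2.2.2⟩
        · have hau := (c₁.mem_alph_iff.1 ha).resolve_right hav
          have d₁ := c₁.Y_of_notMem hau hav
          have d₂ := c₂.Y_of_notMem (au ▸ hau) (av ▸ hav)
          exact ⟨ih d₁.1 d₂.1 (hu₁ a hau).2.2.1 (eqvAux_refl ..),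
            ih d₁.2 d₂.2 (hu₁ a hau).2.2.2 (eqvAux_of_succ_right hv')⟩
    case WI.refine_2 =>
      intro a _ b _
      have key := CDefined_and_eqvAux_Cab (a := a) (b := b) ih c₁ c₂ hu₀ hv₀
      exact ⟨⟨fun h => (key h).1, fun h => (CDefined_and_eqvAux_Cab ih c₂ c₁ (eqvAux_symm hu₀)
        (eqvAux_symm hv₀) h).1⟩, fun h _ => (key h).2⟩

/-- Each relation is refined by the kernel of a map to a finite type. -/
theorem exists_finite_invariant (A : Type) [Finite A] (n : ℕ) (k : ZK) (m : ℕ) :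
    ∃ (F : Type) (f : GWord A → F), Finite F ∧ ∀ u v, f u = f v → eqvAux n k m u v := by
  induction n generalizing k m with
  | zero => exact ⟨Unit, fun _ => (), inferInstance, fun _ _ _ => trivial⟩
  | succ n ih =>
    rcases m with - | m
    · exact ⟨Unit, fun _ => (), inferInstance, fun _ _ _ => by simp [eqvAux]⟩
    obtain ⟨FX, fX, _, hX⟩ := ih .X m
    obtain ⟨FY, fY, _, hY⟩ := ih .Y m
    obtain ⟨FW, fW, _, hW⟩ := ih .WI m
    obtain ⟨FX', fX', _, hX'⟩ := ih .X (m + 1)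
    obtain ⟨FY', fY', _, hY'⟩ := ih .Y (m + 1)
    obtain ⟨FW', fW', _, hW'⟩ := ih .WI (m + 1)
    cases k
    · refine ⟨Set A × FY × (A → FY) × (A → FX'), fun u => (u.alph, fY u,
        fun a => fY (u.XL a), fun a => fX' (u.XR a)), inferInstance, fun u v h => ?_⟩
      simp only [Prod.mk.injEq, funext_iff] at h
      obtain ⟨h₀, h₁, h₂, h₃⟩ := h
      exact ⟨h₀, hY _ _ h₁, fun a _ => ⟨hY _ _ (h₂ a), hX' _ _ (h₃ a)⟩⟩
    · refine ⟨Set A × FX × (A → FY') × (A → FX), fun u => (u.alph, fX u,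
        fun a => fY' (u.YL a), fun a => fX (u.YR a)), inferInstance, fun u v h => ?_⟩
      simp only [Prod.mk.injEq, funext_iff] at h
      obtain ⟨h₀, h₁, h₂, h₃⟩ := h
      exact ⟨h₀, hX _ _ h₁, fun a _ => ⟨hY' _ _ (h₂ a), hX _ _ (h₃ a)⟩⟩
    · refine ⟨Set A × (A → FW × FW' × FW' × FW) × (A → A → Prop × FW), fun u => (u.alph,
        fun a => (fW (u.XL a), fW' (u.XR a), fW' (u.YL a), fW (u.YR a)),
        fun a b => (u.CDefined a b, fW (u.Cab a b))), inferInstance, fun u v h => ?_⟩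
      simp only [Prod.mk.injEq, funext_iff] at h
      obtain ⟨h₀, h₁, h₂⟩ := h
      exact ⟨h₀, fun a _ => ⟨hW _ _ (h₁ a).1, hW' _ _ (h₁ a).2.1, hW' _ _ (h₁ a).2.2.1,
        hW _ _ (h₁ a).2.2.2⟩, fun a _ b _ => ⟨iff_of_eq (h₂ a b).1,
        fun _ _ => hW _ _ (h₂ a b).2⟩⟩

theorem Quot.finite_of_invariant {α F : Type*} [Finite F] {r : α → α → Prop} (f : α → F)
    (h : ∀ x y, f x = f y → r x y) : Finite (Quot r) := by
  refine Finite.of_injective (fun q : Quot r => f q.out) fun p q hpq => ?_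
  rw [← Quot.out_eq p, ← Quot.out_eq q]
  exact Quot.sound (h _ _ hpq)

/-- The relations `≡_{m,n}^Z` are congruences of finite index on `Σ*`. -/
theorem relations_are_finite_index_congruences (A : Type) [Fintype A] (m n : ℕ)
    (Z : ZKind) :
    Equivalence (fun u v : List A => wEquiv Z m n (GWord.ofList u) (GWord.ofList v)) ∧
    (∀ u₁ u₂ v₁ v₂ : List A,
      wEquiv Z m n (GWord.ofList u₁) (GWord.ofList u₂) →
      wEquiv Z m n (GWord.ofList v₁) (GWord.ofList v₂) →
      wEquiv Z m n (GWord.ofList (u₁ ++ v₁)) (GWord.ofList (u₂ ++ v₂))) ∧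
    Finite (Quot (fun u v : List A => wEquiv Z m n (GWord.ofList u) (GWord.ofList v))) := by
  refine ⟨⟨fun u => ?_, fun {u v} h => ?_, fun {u v w} h h' => ?_⟩, fun u₁ u₂ v₁ v₂ hu hv => ?_, ?_⟩
  · cases Z <;> simp [wEquiv, eqvAux_refl]
  · cases Z
    case XY => exact ⟨eqvAux_symm h.1, eqvAux_symm h.2⟩
    all_goals exact eqvAux_symm h
  · cases Z
    case XY => exact ⟨eqvAux_trans h.1 h'.1, eqvAux_trans h.2 h'.2⟩
    all_goals exact eqvAux_trans h h'
  · have c₁ := isCat_ofList u₁ v₁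
    have c₂ := isCat_ofList u₂ v₂
    cases Z
    case XY => exact ⟨eqvAux_of_isCat c₁ c₂ hu.1 hv.1, eqvAux_of_isCat c₁ c₂ hu.2 hv.2⟩
    all_goals exact eqvAux_of_isCat c₁ c₂ hu hv
  · obtain ⟨FX, fX, _, hX⟩ := exists_finite_invariant A n .X m
    obtain ⟨FY, fY, _, hY⟩ := exists_finite_invariant A n .Y m
    obtain ⟨FW, fW, _, hW⟩ := exists_finite_invariant A n .WI m
    cases Z
    · exact Quot.finite_of_invariant (fun u => fX (GWord.ofList u)) fun u v h => hX _ _ h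
    · exact Quot.finite_of_invariant (fun u => fY (GWord.ofList u)) fun u v h => hY _ _ h
    · exact Quot.finite_of_invariant (fun u => (fX (GWord.ofList u), fY (GWord.ofList u)))
        fun u v h => ⟨hX _ _ (Prod.mk.inj h).1, hY _ _ (Prod.mk.inj h).2⟩
    · exact Quot.finite_of_invariant (fun u => fW (GWord.ofList u)) fun u v h => hW _ _ h
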